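/- arXiv:1511.08353 — 5 statements merged into one kernel-verified Lean document; each statement's English description precedes it below -/
import Mathlib

section
/- Let p = 2, let t ≥ 1 be an integer and r = 2^t. In the polynomial ring F_2[T], define F_0 = 1, F_1 = T and F_{n+1} = T·F_n + F_{n−1} for n ≥ 1. Then F_{r−1} = T^{r−1}. -/
open Polynomial

/-- Doubling formulas in characteristic two for a sequence with `F 0 = 1`, `F 1 = x` and
`F (n + 2) = x * F (n + 1) + F n`. -/
theorem fib_doubling_char_two {R : Type*} [CommRing R] [CharP R 2] {x : R} {F : ℕ → R}
    (h0 : F 0 = 1) (h1 : F 1 = x) (hF : ∀ n, F (n + 2) = x * F (n + 1) + F n) (n : ℕ) :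
    F (2 * n + 1) = x * F n ^ 2 ∧ F (2 * n + 2) = F (n + 1) ^ 2 + F n ^ 2 := by
  have two : (2 : R) = 0 := CharTwo.two_eq_zero
  induction n with
  | zero => simp [h0, h1, hF 0, sq]
  | succ n ih =>
    obtain ⟨h_odd, h_even⟩ := ih
    have h_odd' : F (2 * (n + 1) + 1) = x * F (n + 1) ^ 2 := by
      rw [show 2 * (n + 1) + 1 = 2 * n + 1 + 2 by ring, hF, h_even, h_odd]
      linear_combination x * F n ^ 2 * two
    refine ⟨h_odd', ?_⟩
    rw [hF (2 * (n + 1)), h_odd', show 2 * (n + 1) = 2 * n + 2 by ring, h_even, hF n]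
    linear_combination -(x * F (n + 1) * F n) * two

/-- In `F₂[T]` define `F 0 = 1`, `F 1 = T` and
`F (n+1) = T·F n + F (n−1)` for `n ≥ 1`.  Then, for `r = 2^t` with `t ≥ 1`,
one has `F (r−1) = T^(r−1)`. -/
theorem fib_poly_char_two {t : ℕ} (ht : 1 ≤ t) {r : ℕ} (hr : r = 2 ^ t)
    (F : ℕ → Polynomial (ZMod 2)) (hF0 : F 0 = 1) (hF1 : F 1 = X)
    (hFrec : ∀ n : ℕ, 1 ≤ n → F (n + 1) = X * F n + F (n - 1)) :
    F (r - 1) = X ^ (r - 1) := by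
  subst hr
  clear ht
  induction t with
  | zero => simp [hF0]
  | succ t ih =>
    have hpos : 0 < 2 ^ t := by positivity
    have hexp : 2 ^ (t + 1) - 1 = 2 * (2 ^ t - 1) + 1 := by omega
    rw [hexp, (fib_doubling_char_two hF0 hF1 (fun n => hFrec (n + 1) n.succ_pos) _).1, ih]
    ring
end

section
/- Let p be an odd prime, let t ≥ 1 be an integer and r = p^t. In the polynomial ring F_p[T], define F_0 = 1, F_1 = T and F_{n+1} = T·F_n + F_{n−1} for n ≥ 1. Then F_{r−1} = (T² + 4)^{(r−1)/2}. -/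
open Polynomial

/-- Binet's formula for the sequence `f 0 = 1`, `f 1 = a + b`,
`f (n + 1) = (a + b) * f n + f (n - 1)`, where `a * b = -1`. -/
theorem sub_mul_fib_eq_pow_sub_pow {R : Type*} [CommRing R] {a b : R} (hab : a * b = -1)
    (f : ℕ → R) (h0 : f 0 = 1) (h1 : f 1 = a + b)
    (hrec : ∀ n : ℕ, 1 ≤ n → f (n + 1) = (a + b) * f n + f (n - 1)) (n : ℕ) :
    (a - b) * f n = a ^ (n + 1) - b ^ (n + 1) := by
  induction n using Nat.twoStepInduction with
  | zero => simp [h0]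
  | one => rw [h1]; ring
  | more n ih₀ ih₁ =>
    have h := hrec (n + 1) (by lia)
    rw [Nat.add_sub_cancel] at h
    rw [h]
    linear_combination (a + b) * ih₁ + ih₀ + (a ^ (n + 1) - b ^ (n + 1)) * hab

/-- Let `p` be an odd prime, `t ≥ 1` and `r = p^t`.  In `F_p[T]` define
`F 0 = 1`, `F 1 = T` and `F (n+1) = T·F n + F (n−1)` for `n ≥ 1`.  Then
`F (r−1) = (T² + 4)^((r−1)/2)`. -/
theorem fib_poly_odd_char {p : ℕ} [Fact p.Prime] (hodd : Odd p)
    {t : ℕ} (ht : 1 ≤ t) {r : ℕ} (hr : r = p ^ t)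
    (F : ℕ → Polynomial (ZMod p)) (hF0 : F 0 = 1) (hF1 : F 1 = X)
    (hFrec : ∀ n : ℕ, 1 ≤ n → F (n + 1) = X * F n + F (n - 1)) :
    F (r - 1) = (X ^ 2 + 4) ^ ((r - 1) / 2) := by
  obtain ⟨K, _, _, φ, hφ⟩ : ∃ (K : Type) (_ : Field K) (_ : IsAlgClosed K)
      (φ : (ZMod p)[X] →+* K), Function.Injective φ :=
    ⟨AlgebraicClosure (FractionRing (ZMod p)[X]), inferInstance, inferInstance,
      (algebraMap (FractionRing (ZMod p)[X]) _).comp (algebraMap _ _),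
      (algebraMap (FractionRing (ZMod p)[X]) _).injective.comp (IsFractionRing.injective _ _)⟩
  have : CharP K p := charP_of_injective_ringHom hφ p
  have h2 : (2 : K) ≠ 0 := Ring.two_ne_zero <| by
    rw [ringChar.eq K p]
    rintro rfl
    exact absurd hodd (by decide)
  obtain ⟨d, hd⟩ := IsAlgClosed.exists_pow_nat_eq (φ (X ^ 2 + 4)) two_pos
  have hd0 : d ≠ 0 := by
    rintro rfl
    have h : (X ^ 2 + C 4 : (ZMod p)[X]) = 0 := hφ (by simpa [map_ofNat C] using hd.symm)
    exact (monic_X_pow_add_C (4 : ZMod p) two_ne_zero).ne_zero h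
  have hd' : d ^ 2 = φ X ^ 2 + 4 := by rw [hd, map_add, map_pow, map_ofNat]
  have hsum : (φ X + d) / 2 + (φ X - d) / 2 = φ X := by field_simp; ring
  have hprod : (φ X + d) / 2 * ((φ X - d) / 2) = -1 := by
    field_simp
    linear_combination -hd'
  have hsub : (φ X + d) / 2 - (φ X - d) / 2 = d := by field_simp; ring
  have hr_odd : Odd r := hr ▸ hodd.pow
  obtain ⟨m, hm⟩ := hr_odd
  have hbinet := sub_mul_fib_eq_pow_sub_pow hprod (fun n => φ (F n)) (by simp [hF0])
    (by simp [hF1, hsum]) (fun n hn => by simp [hFrec n hn, hsum]) (r - 1)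
  rw [Nat.sub_add_cancel (by lia), hr, ← sub_pow_char_pow, hsub, ← hr] at hbinet
  apply hφ
  apply mul_left_cancel₀ hd0
  rw [hbinet, map_pow, ← hd, hm, ← pow_mul, ← pow_succ']
  congr 1
  lia
end

section
/- Let K be a field and n ≥ 2. Let x_1, x_2, …, x_n and x be elements of K such that all continuants and finite continued fractions occurring below are defined (all relevant denominators are nonzero). Then [[x_1, x_2, …, x_n], x] = [x_1, x_2, …, x_n, y], where y = (−1)^{n−1}·⟨x_2, …, x_n⟩^{-2}·x − ⟨x_2, …, x_{n−1}⟩·⟨x_2, …, x_n⟩^{-1}. -/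
/-- The continuant `⟨x₁, …, xₙ⟩`, defined by `⟨⟩ = 1`, `⟨x₁⟩ = x₁` and
`⟨x₁, …, xₙ⟩ = xₙ·⟨x₁, …, x_{n−1}⟩ + ⟨x₁, …, x_{n−2}⟩`.  (By the symmetry
`⟨x₁, …, xₙ⟩ = ⟨xₙ, …, x₁⟩` of continuants, this is equivalently computed by the
recursion on the first entry used here: `⟨x₁, …, xₙ⟩ = x₁·⟨x₂, …, xₙ⟩ + ⟨x₃, …, xₙ⟩`.) -/
def cont {K : Type*} [Field K] : List K → K
  | [] => 1
  | [x] => x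
  | x :: y :: l => x * cont (y :: l) + cont l

/-- The finite continued fraction `[x₁, …, xₙ]`, defined by `[x₁] = x₁` and
`[x₁, x₂, …, xₙ] = x₁ + 1/[x₂, …, xₙ]`. -/
def cfrac {K : Type*} [Field K] : List K → K
  | [] => 0
  | [x] => x
  | x :: y :: l => x + (cfrac (y :: l))⁻¹

theorem cont_append_pair {K : Type*} [Field K] (a b : K) :
    ∀ l : List K, cont (l ++ [a, b]) = b * cont (l ++ [a]) + cont l
  | [] => by simp [cont, mul_comm]
  | [x] => by simp [cont]; ring
  | x :: y :: l => by
    have h₁ := cont_append_pair a b (y :: l)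
    have h₂ := cont_append_pair a b l
    simp only [List.cons_append, cont] at h₁ h₂ ⊢
    rw [h₁, h₂]
    ring

theorem cont_mul_cont_sub {K : Type*} [Field K] (x a : K) (l : List K) :
    cont (x :: (l ++ [a])) * cont l - cont (x :: l) * cont (l ++ [a]) = (-1) ^ l.length := by
  induction l generalizing x with
  | nil => simp [cont]
  | cons b l ih =>
    have h := ih b
    simp only [List.cons_append, cont, List.length_cons, pow_succ] at h ⊢
    rw [← h]
    ring

theorem cont_ne_zero_and_cfrac_cons {K : Type*} [Field K] (x : K) (l : List K)
    (h : ∀ k < l.length, cfrac (l.drop k) ≠ 0) :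
    cont l ≠ 0 ∧ cfrac (x :: l) = cont (x :: l) / cont l := by
  induction l generalizing x with
  | nil => simp [cont, cfrac]
  | cons b l ih =>
    obtain ⟨hl, hb⟩ := ih b fun k hk => by simpa using h (k + 1) (by simpa using hk)
    have hbl : cont (b :: l) ≠ 0 := by
      have h₀ := h 0 (by simp)
      rw [List.drop_zero, hb] at h₀
      exact (div_ne_zero_iff.mp h₀).1
    refine ⟨hbl, ?_⟩
    simp only [cfrac, cont, hb]
    field_simp

/-- **Lemma 2.** Let `K` be a field and `n ≥ 2`.  Let `x₁, …, xₙ` (given as a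
list `L` of length `n`) and `x` be elements of `K` such that all continuants and finite
continued fractions occurring are defined (all relevant denominators are nonzero).  Then
`[[x₁, …, xₙ], x] = [x₁, …, xₙ, y]` where
`y = (−1)^{n−1}·⟨x₂, …, xₙ⟩⁻² · x − ⟨x₂, …, x_{n−1}⟩·⟨x₂, …, xₙ⟩⁻¹`. -/
theorem cfrac_append_last {K : Type*} [Field K] (L : List K) (n : ℕ)
    (hn : n = L.length) (hn2 : 2 ≤ n) (x : K) (y : K)
    (hy : y = (-1 : K) ^ (n - 1) * ((cont (L.drop 1))⁻¹) ^ 2 * x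
            - cont ((L.drop 1).dropLast) * (cont (L.drop 1))⁻¹)
    -- definedness assumptions: all denominators occurring are nonzero
    (hx : x ≠ 0)
    (hcont : cont (L.drop 1) ≠ 0)
    (hL : ∀ k : ℕ, 1 ≤ k → k < n → cfrac (L.drop k) ≠ 0)
    (hLy : ∀ k : ℕ, 1 ≤ k → k ≤ n → cfrac ((L ++ [y]).drop k) ≠ 0) :
    cfrac [cfrac L, x] = cfrac (L ++ [y]) := by
  obtain _ | ⟨c, M⟩ := L
  · simp at hn
    omega
  obtain rfl | ⟨l, a, rfl⟩ := List.eq_nil_or_concat' M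
  · simp at hn
    omega
  simp only [List.drop_succ_cons, List.drop_zero, List.dropLast_concat] at hy hcont
  simp only [List.length_cons, List.length_append, List.length_nil] at hn
  obtain ⟨-, hp⟩ := cont_ne_zero_and_cfrac_cons c (l ++ [a]) fun k hk => by
    simpa using hL (k + 1) (by omega) (by simp at hk; omega)
  obtain ⟨hq, hp'⟩ := cont_ne_zero_and_cfrac_cons c (l ++ [a, y]) fun k hk => by
    simpa using hLy (k + 1) (by omega) (by simp at hk; omega)
  have hdet := cont_mul_cont_sub c a l
  have happ := cont_append_pair a y (c :: l)
  simp only [List.cons_append] at happ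
  have hassoc : c :: (l ++ [a]) ++ [y] = c :: (l ++ [a, y]) := by simp
  rw [hassoc, hp', happ]
  rw [cont_append_pair] at hq ⊢
  simp only [cfrac, hp]
  have hn1 : n - 1 = l.length + 1 := by omega
  rw [hn1, pow_succ, ← hdet] at hy
  generalize cont (c :: (l ++ [a])) = p at *
  generalize cont (l ++ [a]) = q at *
  generalize cont (c :: l) = p' at *
  generalize cont l = q' at *
  have hden : q * (y * q + q') = -(p * q' - p' * q) * x := by
    rw [hy]
    field_simp
    ring
  rw [eq_div_iff hq]
  field_simp
  linear_combination hden
end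

section
/- Let q = 2^s and r = 2^t with s, t ≥ 1 integers, and work in F(q) = F_q((T^{-1})) with the ultrametric absolute value. Let F_0 = 1, F_1 = T, F_{n+1} = T·F_n + F_{n−1} in F_2[T]. Let α = [a_1, a_2, …] be an infinite continued fraction in F(q) with partial quotients a_n ∈ F_q[T] of positive degree, and complete quotients α_n (so α_n = a_n + 1/α_{n+1} with |α_{n+1}| > 1). Suppose there are ε_1, ε_2 ∈ F_q^* and integers 1 ≤ i < j with α_i^r = ε_1·F_{r−1}·α_j + ε_2·F_{r−2}, and that a_i = λ_i·T with λ_i ∈ F_q^*. Then: a_j = ε_1^{-1}·λ_i^r·T; a_{j+k} = (ε_2/ε_1)^{(−1)^k}·T for 1 ≤ k ≤ r−1; and α_{i+1}^r = ε_1·ε_2^{-2}·F_{r−1}·α_{j+r} + ε_2^{-1}·F_{r−2}. -/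
open scoped Classical

/-- The ultrametric absolute value on `F((1/T)) = F_q((T⁻¹))`, realized as the field
`LaurentSeries F` of Laurent series in `X = T⁻¹`: for `α ≠ 0`, `|α| = c^{-order α}`
(`= |T|^{deg α}`), where `c = |T| > 1` is a fixed real number. -/
noncomputable def absv {F : Type*} [Field F] (c : ℝ) (α : LaurentSeries F) : ℝ :=
  if α = 0 then 0 else c ^ (-α.order)

namespace HyperquadraticStep

variable {K : Type*} [Field K]

/-- The additive valuation `-deg` on `K((1/T))`. -/
noncomputable abbrev ordVal : AddValuation (LaurentSeries K) (WithTop ℤ) := HahnSeries.addVal ℤ K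

lemma ordVal_single (n : ℤ) {x : K} (hx : x ≠ 0) :
    ordVal (HahnSeries.single n x : LaurentSeries K) = (n : WithTop ℤ) := by
  rw [ordVal, HahnSeries.addVal_apply, HahnSeries.orderTop_single hx]

lemma ordVal_algebraMap {x : K} (hx : x ≠ 0) :
    ordVal (algebraMap K (LaurentSeries K) x) = ((0 : ℤ) : WithTop ℤ) := by
  have : algebraMap K (LaurentSeries K) x = HahnSeries.single 0 x := by
    rw [LaurentSeries.algebraMap_apply]; rfl
  rw [this, ordVal_single _ hx]

lemma single_neg_one_pow (n : ℕ) :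
    (HahnSeries.single (-1 : ℤ) 1 : LaurentSeries K) ^ n = HahnSeries.single (-(n : ℤ)) 1 := by
  rw [HahnSeries.single_pow]; simp

lemma coeff_aeval_single (p : Polynomial K) (n : ℕ) :
    (Polynomial.aeval (HahnSeries.single (-1 : ℤ) 1 : LaurentSeries K) p).coeff (-(n : ℤ))
      = p.coeff n := by
  induction p using Polynomial.induction_on' with
  | add p q hp hq => simp [hp, hq]
  | monomial m x =>
    rw [Polynomial.aeval_monomial, single_neg_one_pow, LaurentSeries.algebraMap_apply,
      Polynomial.coeff_monomial]
    simp [HahnSeries.coeff_single, eq_comm]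

/-- A polynomial in `T` of positive valuation vanishes. -/
lemma eq_zero_of_one_le_ordVal_aeval {p : Polynomial K}
    (h : ((1 : ℤ) : WithTop ℤ)
      ≤ ordVal (Polynomial.aeval (HahnSeries.single (-1 : ℤ) 1 : LaurentSeries K) p)) :
    p = 0 := by
  ext n
  rw [← coeff_aeval_single, Polynomial.coeff_zero]
  apply HahnSeries.coeff_eq_zero_of_lt_orderTop
  rw [ordVal, HahnSeries.addVal_apply] at h
  refine lt_of_lt_of_le ?_ h
  exact_mod_cast (by omega : -(n : ℤ) < 1)

lemma le_ordVal_mul {x y : LaurentSeries K} {a b : ℤ} (hx : (a : WithTop ℤ) ≤ ordVal x)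
    (hy : (b : WithTop ℤ) ≤ ordVal y) : ((a + b : ℤ) : WithTop ℤ) ≤ ordVal (x * y) := by
  rw [AddValuation.map_mul, WithTop.coe_add]
  exact add_le_add hx hy

lemma ordVal_mul {x y : LaurentSeries K} {a b : ℤ} (hx : ordVal x = (a : WithTop ℤ))
    (hy : ordVal y = (b : WithTop ℤ)) : ordVal (x * y) = ((a + b : ℤ) : WithTop ℤ) := by
  rw [AddValuation.map_mul, hx, hy, WithTop.coe_add]

lemma ordVal_pow {x : LaurentSeries K} {a : ℤ} (hx : ordVal x = (a : WithTop ℤ)) (n : ℕ) :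
    ordVal (x ^ n) = ((n * a : ℤ) : WithTop ℤ) := by
  induction n with
  | zero => simp
  | succ n ih => rw [pow_succ, ordVal_mul ih hx]; congr 1; push_cast; ring

lemma ordVal_add_eq_left {x y : LaurentSeries K} {a : ℤ} (hx : ordVal x = (a : WithTop ℤ))
    (hy : ((a + 1 : ℤ) : WithTop ℤ) ≤ ordVal y) : ordVal (x + y) = (a : WithTop ℤ) := by
  rw [← hx]
  refine AddValuation.map_add_eq_of_lt_left (ordVal (K := K)) ?_
  rw [hx]
  refine lt_of_lt_of_le ?_ hy
  exact_mod_cast lt_add_one a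

lemma one_le_ordVal_of_mul_eq {x y z : LaurentSeries K} {d : ℤ} (h : x * y = z)
    (hy : ordVal y = (d : WithTop ℤ)) (hz : ((d + 1 : ℤ) : WithTop ℤ) ≤ ordVal z) :
    ((1 : ℤ) : WithTop ℤ) ≤ ordVal x := by
  rw [← h, AddValuation.map_mul, hy] at hz
  induction hx : ordVal x using WithTop.recTopCoe with
  | top => exact le_top
  | coe n =>
    rw [hx] at hz
    norm_cast at hz ⊢
    omega

/-- Uniqueness of the polynomial part. -/
lemma eq_of_aeval_add {α y : LaurentSeries K} {p q : Polynomial K}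
    (hα : α = Polynomial.aeval (HahnSeries.single (-1 : ℤ) 1 : LaurentSeries K) p + y)
    (hy : ((1 : ℤ) : WithTop ℤ) ≤ ordVal y)
    (hq : ((1 : ℤ) : WithTop ℤ) ≤
      ordVal (α - Polynomial.aeval (HahnSeries.single (-1 : ℤ) 1 : LaurentSeries K) q)) :
    p = q := by
  rw [← sub_eq_zero]
  apply eq_zero_of_one_le_ordVal_aeval
  have : Polynomial.aeval (HahnSeries.single (-1 : ℤ) 1 : LaurentSeries K) (p - q)
      = (α - Polynomial.aeval (HahnSeries.single (-1 : ℤ) 1 : LaurentSeries K) q) - y := by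
    rw [map_sub, hα]; ring
  rw [this]
  exact AddValuation.map_le_sub _ hq hy

lemma ordVal_of_one_lt_absv {c : ℝ} (hc : 1 < c) {α : LaurentSeries K} (h : 1 < absv c α) :
    α ≠ 0 ∧ ∃ d : ℤ, d ≤ -1 ∧ ordVal α = (d : WithTop ℤ) := by
  unfold absv at h
  split_ifs at h with h0
  · norm_num at h
  · rw [one_lt_zpow_iff_right₀ hc] at h
    refine ⟨h0, α.order, by omega, ?_⟩
    rw [ordVal, HahnSeries.addVal_apply, HahnSeries.order_eq_orderTop_of_ne_zero h0]

lemma one_le_ordVal_inv_pow {α : LaurentSeries K} {d : ℤ} (hd : d ≤ -1) (h0 : α ≠ 0)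
    (h : ordVal α = (d : WithTop ℤ)) {n : ℕ} (hn : 1 ≤ n) :
    ((1 : ℤ) : WithTop ℤ) ≤ ordVal (α ^ n)⁻¹ := by
  refine one_le_ordVal_of_mul_eq (inv_mul_cancel₀ (pow_ne_zero n h0)) (ordVal_pow h n) ?_
  rw [AddValuation.map_one]
  have : (n : ℤ) * d + 1 ≤ 0 := by nlinarith
  exact_mod_cast this

section Fibonacci

variable {G : ℕ → LaurentSeries K} {T : LaurentSeries K}

lemma ordVal_fibonacci (hT : ordVal T = ((-1 : ℤ) : WithTop ℤ)) (h0 : G 0 = 0) (h1 : G 1 = 1)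
    (hG : ∀ n, G (n + 2) = T * G (n + 1) + G n) (n : ℕ) :
    ordVal (G (n + 1)) = ((-n : ℤ) : WithTop ℤ) := by
  induction n using Nat.twoStepInduction with
  | zero => simp [h1]
  | one => rw [hG, h1, h0]; simp [hT]
  | more n ih1 ih2 =>
    rw [hG, show (-((n + 2 : ℕ) : ℤ)) = -1 + -((n + 1 : ℕ) : ℤ) by push_cast; ring]
    refine ordVal_add_eq_left (ordVal_mul hT ih2) ?_
    rw [ih1]
    exact_mod_cast (by push_cast; omega : -1 + -((n + 1 : ℕ) : ℤ) + 1 ≤ -(n : ℤ))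

lemma le_ordVal_fibonacci (hT : ordVal T = ((-1 : ℤ) : WithTop ℤ)) (h0 : G 0 = 0)
    (h1 : G 1 = 1) (hG : ∀ n, G (n + 2) = T * G (n + 1) + G n) (n : ℕ) :
    ((1 - n : ℤ) : WithTop ℤ) ≤ ordVal (G n) := by
  cases n with
  | zero => rw [h0, AddValuation.map_zero]; exact le_top
  | succ n =>
    rw [ordVal_fibonacci hT h0 h1 hG]
    exact_mod_cast (by push_cast; omega : 1 - ((n + 1 : ℕ) : ℤ) ≤ -(n : ℤ))

lemma fibonacci_double (h2 : (2 : LaurentSeries K) = 0) (h0 : G 0 = 0) (h1 : G 1 = 1)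
    (hG : ∀ n, G (n + 2) = T * G (n + 1) + G n) (n : ℕ) :
    G (2 * n) = T * G n ^ 2 ∧ G (2 * n + 1) = G (n + 1) ^ 2 + G n ^ 2 := by
  induction n with
  | zero => simp [h0, h1]
  | succ n ih =>
    obtain ⟨ih1, ih2⟩ := ih
    have e : G (2 * (n + 1)) = T * G (n + 1) ^ 2 := by
      rw [show 2 * (n + 1) = 2 * n + 2 by ring, hG, ih1, ih2]
      linear_combination T * G n ^ 2 * h2
    refine ⟨e, ?_⟩
    rw [show 2 * (n + 1) + 1 = (2 * n + 1) + 2 by ring, hG (2 * n + 1), hG n,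
      show 2 * n + 1 + 1 = 2 * (n + 1) by ring, e, ih2]
    linear_combination (-(T * G (n + 1) * G n)) * h2

lemma fibonacci_two_pow (h2 : (2 : LaurentSeries K) = 0) (h0 : G 0 = 0) (h1 : G 1 = 1)
    (hG : ∀ n, G (n + 2) = T * G (n + 1) + G n) (t : ℕ) :
    T * G (2 ^ t) = T ^ 2 ^ t := by
  induction t with
  | zero => simp [h1]
  | succ t ih =>
    rw [pow_succ, mul_comm (2 ^ t), (fibonacci_double h2 h0 h1 hG _).1, pow_mul, sq, pow_right_comm]
    rw [sq, ← ih]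
    ring

end Fibonacci

end HyperquadraticStep

open HyperquadraticStep in
/-- **Lemma 3.** Let `q = 2^s`, `r = 2^t` (`s, t ≥ 1`), and work in
`F(q) = F_q((T⁻¹))` with the ultrametric absolute value.  Let `F 0 = 1`, `F 1 = T`,
`F (n+1) = T·F n + F (n−1)`.  Let `α = [a₁, a₂, …]` be an infinite continued fraction in
`F(q)` with partial quotients `aₙ ∈ F_q[T]` of positive degree and complete quotients `αₙ`
(so `αₙ = aₙ + 1/α_{n+1}` with `|α_{n+1}| > 1`).  Suppose `ε₁, ε₂ ∈ F_q^*` and `1 ≤ i < j`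
satisfy `αᵢ^r = ε₁·F_{r−1}·αⱼ + ε₂·F_{r−2}`, and `aᵢ = λᵢ·T` with `λᵢ ∈ F_q^*`.  Then
`aⱼ = ε₁⁻¹·λᵢ^r·T`, `a_{j+k} = (ε₂/ε₁)^((−1)^k)·T` for `1 ≤ k ≤ r−1`, and
`α_{i+1}^r = ε₁·ε₂⁻²·F_{r−1}·α_{j+r} + ε₂⁻¹·F_{r−2}`. -/
theorem hyperquadratic_step {s t : ℕ} (hs : 1 ≤ s) (ht : 1 ≤ t) {r : ℕ} (hr : r = 2 ^ t)
    (c : ℝ) (hc : 1 < c)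
    (T : LaurentSeries (GaloisField 2 s)) (hT : T = HahnSeries.single (-1 : ℤ) 1)
    (F : ℕ → LaurentSeries (GaloisField 2 s)) (hF0 : F 0 = 1) (hF1 : F 1 = T)
    (hFrec : ∀ n : ℕ, 1 ≤ n → F (n + 1) = T * F n + F (n - 1))
    (a : ℕ → Polynomial (GaloisField 2 s)) (A : ℕ → LaurentSeries (GaloisField 2 s))
    (hdeg : ∀ n : ℕ, 1 ≤ n → 0 < (a n).degree)
    (hCF : ∀ n : ℕ, 1 ≤ n → A n = Polynomial.aeval T (a n) + (A (n + 1))⁻¹)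
    (habs : ∀ n : ℕ, 2 ≤ n → 1 < absv c (A n))
    (ε₁ ε₂ : GaloisField 2 s) (hε₁ : ε₁ ≠ 0) (hε₂ : ε₂ ≠ 0)
    (i j : ℕ) (hi : 1 ≤ i) (hij : i < j)
    (heq : (A i) ^ r =
      algebraMap (GaloisField 2 s) (LaurentSeries (GaloisField 2 s)) ε₁ * F (r - 1) * A j
      + algebraMap (GaloisField 2 s) (LaurentSeries (GaloisField 2 s)) ε₂ * F (r - 2))
    (lam : GaloisField 2 s) (hlam : lam ≠ 0)
    (hai : a i = Polynomial.C lam * Polynomial.X) :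
    a j = Polynomial.C (ε₁⁻¹ * lam ^ r) * Polynomial.X ∧
    (∀ k : ℕ, 1 ≤ k → k ≤ r - 1 →
      a (j + k) = Polynomial.C ((ε₂ / ε₁) ^ ((-1 : ℤ) ^ k)) * Polynomial.X) ∧
    (A (i + 1)) ^ r =
      algebraMap (GaloisField 2 s) (LaurentSeries (GaloisField 2 s)) (ε₁ * (ε₂⁻¹) ^ 2)
        * F (r - 1) * A (j + r)
      + algebraMap (GaloisField 2 s) (LaurentSeries (GaloisField 2 s)) ε₂⁻¹ * F (r - 2) := by
  have hr2 : 2 ≤ r := hr ▸ le_self_pow₀ (by norm_num) (by omega)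
  have h2K : (2 : GaloisField 2 s) = 0 := CharTwo.two_eq_zero
  have h2 : (2 : LaurentSeries (GaloisField 2 s)) = 0 := by
    have := congrArg (algebraMap (GaloisField 2 s) (LaurentSeries (GaloisField 2 s))) h2K
    rwa [map_ofNat, map_zero] at this
  have : CharP (LaurentSeries (GaloisField 2 s)) 2 :=
    charP_of_injective_algebraMap
      (algebraMap (GaloisField 2 s) (LaurentSeries (GaloisField 2 s))).injective 2
  obtain ⟨G, hG0, hGF⟩ : ∃ G : ℕ → LaurentSeries (GaloisField 2 s),
      G 0 = 0 ∧ ∀ n, G (n + 1) = F n := ⟨fun n => Nat.casesOn n 0 F, rfl, fun _ => rfl⟩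
  have hG1 : G 1 = 1 := by rw [hGF, hF0]
  have hG : ∀ n, G (n + 2) = T * G (n + 1) + G n := by
    intro n
    cases n with
    | zero => rw [hGF, hGF, hG0, hF0, hF1]; ring
    | succ n => rw [hGF, hGF, hGF, hFrec _ (by omega)]; rfl
  have hTv : ordVal T = ((-1 : ℤ) : WithTop ℤ) := by rw [hT, ordVal_single _ one_ne_zero]
  have hGr : T * G r = T ^ r := by rw [hr]; exact fibonacci_two_pow h2 hG0 hG1 hG t
  have hFr1 : F (r - 1) = G r := by rw [← hGF]; congr 1; omega
  have hFr2 : F (r - 2) = G (r - 1) := by rw [← hGF]; congr 1; omega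
  rw [hFr1, hFr2] at heq ⊢
  have hinv : ∀ n, 2 ≤ n → ((1 : ℤ) : WithTop ℤ) ≤ ordVal (A n)⁻¹ := by
    intro n hn
    obtain ⟨h0, d, hd, hv⟩ := ordVal_of_one_lt_absv hc (habs n hn)
    simpa using one_le_ordVal_inv_pow hd h0 hv le_rfl
  have hne : ∀ n, 2 ≤ n → A n ≠ 0 := fun n hn => (ordVal_of_one_lt_absv hc (habs n hn)).1
  obtain ⟨hβ0, d, hd, hdv⟩ := ordVal_of_one_lt_absv hc (habs (i + 1) (by omega))
  have hpow : A i ^ r = (algebraMap _ _ lam * T) ^ r + ((A (i + 1)) ^ r)⁻¹ := by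
    rw [hCF i hi, hai, hr, add_pow_char_pow, inv_pow]
    simp
  have hβinv := one_le_ordVal_inv_pow hd hβ0 hdv (n := r) (by omega)
  have hβv := ordVal_pow hdv r
  have hβ0' : A (i + 1) ^ r ≠ 0 := pow_ne_zero _ hβ0
  generalize A (i + 1) ^ r = β at *
  have hrd : (r : ℤ) * d ≤ -r := by nlinarith
  generalize (r : ℤ) * d = b at *
  have haeval : ∀ x : GaloisField 2 s, Polynomial.aeval T (Polynomial.C x * Polynomial.X)
      = algebraMap _ (LaurentSeries (GaloisField 2 s)) x * T := by intro x; simp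
  have huniq : ∀ (n : ℕ) (x : GaloisField 2 s), 1 ≤ n → ((1 : ℤ) : WithTop ℤ) ≤
      ordVal (A n - algebraMap _ _ x * T) → a n = Polynomial.C x * Polynomial.X := by
    intro n x hn h
    rw [← haeval, hT] at h
    exact eq_of_aeval_add (hT ▸ hCF n hn) (hinv _ (by omega)) h
  -- the partial quotient at `j`
  have hmul : (A j - algebraMap _ _ (ε₁⁻¹ * lam ^ r) * T) * (algebraMap _ _ ε₁ * G r)
      = β⁻¹ + algebraMap _ _ ε₂ * G (r - 1) := by
    rw [hpow] at heq
    have e : algebraMap (GaloisField 2 s) (LaurentSeries (GaloisField 2 s)) (ε₁⁻¹ * lam ^ r)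
        * algebraMap _ _ ε₁ = algebraMap _ _ lam ^ r := by
      rw [← map_mul, ← map_pow]; congr 1; field_simp
    rw [mul_pow, ← hGr] at heq
    linear_combination (-T * G r) * e - heq - algebraMap _ _ ε₂ * G (r - 1) * h2
  have haj : a j = Polynomial.C (ε₁⁻¹ * lam ^ r) * Polynomial.X := by
    apply huniq j _ (by omega)
    have hGrv := ordVal_fibonacci hTv hG0 hG1 hG (r - 1)
    rw [Nat.sub_add_cancel (by omega)] at hGrv
    refine one_le_ordVal_of_mul_eq hmul (ordVal_mul (ordVal_algebraMap hε₁) hGrv) ?_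
    refine AddValuation.map_le_add _ (le_trans ?_ hβinv)
      (le_trans ?_ (le_ordVal_mul (ordVal_algebraMap hε₂).ge
        (le_ordVal_fibonacci hTv hG0 hG1 hG _)))
    all_goals
      rw [WithTop.coe_le_coe]
      omega
  set γ := algebraMap _ (LaurentSeries (GaloisField 2 s)) ε₂ * β with hγ
  have hγv : ordVal γ = (b : WithTop ℤ) := by
    rw [← zero_add b]; exact ordVal_mul (ordVal_algebraMap hε₂) hβv
  set v : ℕ → GaloisField 2 s := fun k => (ε₂ / ε₁) ^ ((-1 : ℤ) ^ k) with hv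
  have hv0 : ∀ k, v k ≠ 0 := fun k => zpow_ne_zero _ (div_ne_zero hε₂ hε₁)
  have hvs : ∀ k, v k * v (k + 1) = 1 := by
    intro k
    simp only [hv]
    rw [pow_succ, mul_neg_one, zpow_neg, mul_inv_cancel₀ (hv0 k)]
  have hbase : A (j + 1) * (G (r - 1) * γ + G 1) = algebraMap _ _ (v 1) * (G r * γ + G 0) := by
    rw [hCF j (by omega), haj, haeval, add_sub_cancel_left] at hmul
    have e : algebraMap (GaloisField 2 s) (LaurentSeries (GaloisField 2 s)) (v 1)
        * algebraMap _ _ ε₂ = algebraMap _ _ ε₁ := by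
      rw [← map_mul]; congr 1; simp only [hv]; simp; field_simp
    have hA := mul_inv_cancel₀ (hne (j + 1) (by omega))
    have hB := mul_inv_cancel₀ hβ0'
    rw [hG0, hG1, hγ]
    linear_combination (-A (j + 1) * β) * hmul + (algebraMap _ _ ε₁ * G r * β) * hA
      - A (j + 1) * hB - G r * β * e
  have hstep : ∀ k m : ℕ, k + (m + 1) + 1 = r →
      A (j + k + 1) * (G (m + 1) * γ + G (k + 1))
        = algebraMap _ _ (v (k + 1)) * (G (m + 2) * γ + G k) →
      a (j + k + 1) = Polynomial.C (v (k + 1)) * Polynomial.X ∧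
      A (j + k + 2) * (G m * γ + G (k + 2))
        = algebraMap _ _ (v (k + 2)) * (G (m + 1) * γ + G (k + 1)) := by
    intro k m hkm h
    have hN : (A (j + k + 1) - algebraMap _ _ (v (k + 1)) * T) * (G (m + 1) * γ + G (k + 1))
        = algebraMap _ _ (v (k + 1)) * (G m * γ + G (k + 2)) := by
      rw [hG m] at h
      rw [hG k]
      linear_combination h - algebraMap _ _ (v (k + 1)) * T * G (k + 1) * h2
    have hD : ordVal (G (m + 1) * γ + G (k + 1)) = ((-m + b : ℤ) : WithTop ℤ) := by
      refine ordVal_add_eq_left (ordVal_mul (ordVal_fibonacci hTv hG0 hG1 hG m) hγv) ?_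
      refine le_trans ?_ (le_ordVal_fibonacci hTv hG0 hG1 hG _)
      rw [WithTop.coe_le_coe]
      omega
    have hak : a (j + k + 1) = Polynomial.C (v (k + 1)) * Polynomial.X := by
      apply huniq _ _ (by omega)
      refine one_le_ordVal_of_mul_eq hN hD ?_
      rw [← zero_add (-(m : ℤ) + b + 1)]
      refine le_ordVal_mul (ordVal_algebraMap (hv0 _)).ge (AddValuation.map_le_add _
        (le_trans ?_ (le_ordVal_mul (le_ordVal_fibonacci hTv hG0 hG1 hG _) hγv.ge))
        (le_trans ?_ (le_ordVal_fibonacci hTv hG0 hG1 hG _)))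
      all_goals
        rw [WithTop.coe_le_coe]
        omega
    refine ⟨hak, ?_⟩
    rw [hCF (j + k + 1) (by omega), hak, haeval, add_sub_cancel_left] at hN
    have hA := mul_inv_cancel₀ (hne (j + k + 1 + 1) (by omega))
    have e : algebraMap (GaloisField 2 s) (LaurentSeries (GaloisField 2 s)) (v (k + 1))
        * algebraMap _ _ (v (k + 2)) = 1 := by
      rw [← map_mul, hvs, map_one]
    change A (j + k + 1 + 1) * _ = _
    linear_combination (-A (j + k + 1 + 1) * algebraMap _ _ (v (k + 2))) * hN
      + (algebraMap _ _ (v (k + 2)) * (G (m + 1) * γ + G (k + 1))) * hA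
      - A (j + k + 1 + 1) * (G m * γ + G (k + 2)) * e
  have hall : ∀ k m : ℕ, k + m + 1 = r →
      A (j + k + 1) * (G m * γ + G (k + 1))
        = algebraMap _ _ (v (k + 1)) * (G (m + 1) * γ + G k) := by
    intro k
    induction k with
    | zero =>
      intro m hkm
      obtain rfl : m = r - 1 := by omega
      rw [Nat.sub_add_cancel (by omega)]
      exact hbase
    | succ k ih =>
      intro m hkm
      exact (hstep k m (by omega) (ih (m + 1) (by omega))).2
  refine ⟨haj, ?_, ?_⟩
  · intro k hk1 hk
    obtain ⟨k, rfl⟩ : ∃ k', k = k' + 1 := ⟨k - 1, by omega⟩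
    obtain ⟨m, hm⟩ : ∃ m, k + (m + 1) + 1 = r := ⟨r - k - 2, by omega⟩
    exact (hstep k m hm (hall k (m + 1) (by omega))).1
  · have h := hall (r - 1) 0 (by omega)
    rw [show j + (r - 1) + 1 = j + r by omega, Nat.sub_add_cancel (by omega), hG0, zero_add, hG1,
      hγ] at h
    have hvr : v r = ε₂ / ε₁ := by
      simp only [hv]
      rw [Even.neg_one_pow, zpow_one]
      rw [hr]
      exact (even_two).pow_of_ne_zero (by omega)
    have e1 : algebraMap (GaloisField 2 s) (LaurentSeries (GaloisField 2 s)) (ε₁ * ε₂⁻¹ ^ 2)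
        * algebraMap _ _ (v r) = algebraMap _ _ ε₂⁻¹ := by
      rw [← map_mul, hvr]; congr 1; field_simp
    have e2 : algebraMap (GaloisField 2 s) (LaurentSeries (GaloisField 2 s)) ε₂⁻¹
        * algebraMap _ _ ε₂ = 1 := by
      rw [← map_mul, inv_mul_cancel₀ hε₂, map_one]
    linear_combination (-algebraMap _ _ (ε₁ * ε₂⁻¹ ^ 2)) * h
      - (algebraMap _ _ ε₂ * β + G (r - 1)) * e1 - β * e2 - algebraMap _ _ ε₂⁻¹ * G (r - 1) * h2
end

section
/- Let q = 2^s with s ≥ 1, let ℓ ≥ 1 be an integer, and let λ_1, …, λ_ℓ, ε_1, ε_2 ∈ F_q^*. Extend (λ_n)_{n≥1} by λ_{ℓ+2m+1} = (ε_2/ε_1)·ε_2^{(−1)^{m+1}}·λ_{m+1}² and λ_{ℓ+2m+2} = ε_1/ε_2 for all m ≥ 0 (the case r = 2 of the recursion). Set θ = Σ_{i≥1} λ_i·T^{-i} ∈ F_q((T^{-1})). Then there exists ρ ∈ F_q((T^{-1})) satisfying ρ² + ρ + T^{-2ℓ}·Σ_{i=1}^{ℓ} (1 + λ_i²·(ε_2/ε_1)²·ε_2^{(−1)^i−(−1)^ℓ})·T^{-2i+2}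 = 0 such that θ = Σ_{i=1}^{ℓ} λ_i·T^{-i} + (ε_1/ε_2)·T^{-ℓ}·(T+1)^{-2}·(ε_2^{(−1)^ℓ}·T + 1) + (ε_1/ε_2)·ε_2^{(−1)^ℓ}·T^{ℓ−1}·ρ. -/
open scoped Classical

namespace PowerSeries

open scoped PowerSeries

variable {R : Type*} [CommRing R]

theorem pow_char_eq_expand_map_frobenius (p : ℕ) [ExpChar R p] (hp : p ≠ 0) (f : R⟦X⟧) :
    f ^ p = expand p hp (map (frobenius R p) f) := by
  rw [← map_expand]
  exact (MvPowerSeries.map_frobenius_expand p hp).symm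

/-- A `2`-automatic recursion on the coefficients of a power series in characteristic two gives
an algebraic equation of degree two. -/
theorem mk_eq_sum_add_X_pow_mul_sq [CharP R 2] (ℓ : ℕ) (g : ℕ → R)
    (h_even : ∀ j, g (ℓ + 2 * j) = g j ^ 2) (h_odd : ∀ j, g (ℓ + (2 * j + 1)) = 0) :
    mk g = ∑ i ∈ Finset.range ℓ, C (g i) * X ^ i + X ^ ℓ * mk g ^ 2 := by
  have : ExpChar R 2 := .prime Nat.prime_two
  rw [pow_char_eq_expand_map_frobenius 2 two_ne_zero]
  ext n
  simp only [coeff_mk, map_add, map_sum, coeff_C_mul, coeff_X_pow, coeff_X_pow_mul',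
    coeff_expand, coeff_map, frobenius_def]
  rcases lt_or_ge n ℓ with h | h
  · simp [h, h.not_ge]
  · obtain ⟨k, rfl⟩ := Nat.exists_eq_add_of_le h
    rcases Nat.even_or_odd' k with ⟨j, rfl | rfl⟩
    · simp [h_even]
    · have : ¬ 2 ∣ 2 * j + 1 := by omega
      simp [h_odd, this]

theorem expand_two_mk_one_mul [CharP R 2] :
    expand 2 two_ne_zero (mk 1 : R⟦X⟧) * (1 + X) ^ 2 = 1 := by
  have h2 : (2 : R⟦X⟧) = 0 := by
    rw [← map_ofNat (C (R := R)), CharTwo.two_eq_zero, map_zero]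
  have h := congrArg (expand 2 two_ne_zero) (mk_one_mul_one_sub_eq_one R)
  simp only [map_mul, map_sub, map_one, expand_X] at h
  linear_combination h + expand 2 two_ne_zero (mk 1 : R⟦X⟧) * (X + X ^ 2) * h2

/-- Splitting a power series without constant term into its first `ℓ` terms and the two parity
classes of the remaining ones, the second of which is constant. -/
theorem mk_eq_sum_add_of_tail (ℓ : ℕ) (a g : ℕ → R) (b c : R)
    (h_odd : ∀ m, a (ℓ + 2 * m + 1) = b * g m) (h_even : ∀ m, a (ℓ + 2 * m + 2) = c) :
    (mk fun i => if 1 ≤ i then a i else 0) = ∑ i ∈ Finset.Icc 1 ℓ, C (a i) * X ^ i +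
      X ^ (ℓ + 1) * (C b * expand 2 two_ne_zero (mk g)) +
      X ^ (ℓ + 2) * (C c * expand 2 two_ne_zero (mk 1)) := by
  ext n
  simp only [coeff_mk, map_add, map_sum, coeff_C_mul, coeff_X_pow, coeff_X_pow_mul', coeff_expand]
  rcases lt_or_ge ℓ n with h | h
  · obtain ⟨k, rfl⟩ := Nat.exists_eq_add_of_le h
    have hs : ∑ i ∈ Finset.Icc 1 ℓ, a i * (if ℓ.succ + k = i then 1 else 0) = 0 :=
      Finset.sum_eq_zero fun i hi => by
        rw [if_neg (by have := (Finset.mem_Icc.1 hi).2; omega), mul_zero]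
    rw [hs]
    rcases Nat.even_or_odd' k with ⟨j, rfl | rfl⟩
    · have h₁ : ¬ (ℓ + 2 ≤ ℓ.succ + 2 * j ∧ 2 ∣ ℓ.succ + 2 * j - (ℓ + 2)) := by omega
      have h₂ : ℓ.succ + 2 * j - (ℓ + 1) = 2 * j := by omega
      have h₃ : ℓ.succ + 2 * j = ℓ + 2 * j + 1 := by omega
      rw [h₂, if_pos (by omega), if_pos (by omega), if_pos (by omega), h₃, h_odd, ← h₃]
      by_cases h₄ : ℓ + 2 ≤ ℓ.succ + 2 * j
      · rw [if_pos h₄, if_neg fun h₅ => h₁ ⟨h₄, h₅⟩]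
        simp
      · rw [if_neg h₄]
        simp
    · have h₃ : ℓ.succ + (2 * j + 1) = ℓ + 2 * j + 2 := by omega
      have h₂ : ℓ + 2 * j + 2 - (ℓ + 2) = 2 * j := by omega
      rw [h₃, h₂, h_even, if_pos (by omega), if_pos (by omega), if_neg (by omega),
        if_pos (by omega), if_pos (by omega)]
      simp
  · rw [if_neg (by omega : ¬ ℓ + 1 ≤ n), if_neg (by omega : ¬ ℓ + 2 ≤ n)]
    by_cases hn : 1 ≤ n
    · simp [hn, h]
    · simp [hn]

end PowerSeries

/-- Let `q = 2^s` (`s ≥ 1`), `ℓ ≥ 1`, and `λ₁, …, λ_ℓ, ε₁, ε₂ ∈ F_q^*`.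
Extend `(λₙ)_{n≥1}` by `λ_{ℓ+2m+1} = (ε₂/ε₁)·ε₂^((−1)^{m+1})·λ_{m+1}²` and
`λ_{ℓ+2m+2} = ε₁/ε₂` for `m ≥ 0` (the case `r = 2`).  Set `θ = Σ_{i≥1} λᵢ·T^{−i}` in
`F_q((T⁻¹))`, realized as `LaurentSeries F_q` in the variable `X = T⁻¹` (so `T` is the
Laurent series `single (−1) 1` and `θ` is the power series with coefficient `λᵢ` on
`X^i = T^{−i}`).  Then there exists `ρ` with
`ρ² + ρ + T^{−2ℓ}·Σ_{i=1}^{ℓ} (1 + λᵢ²·(ε₂/ε₁)²·ε₂^((−1)^i−(−1)^ℓ))·T^{−2i+2} = 0`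
such that
`θ = Σ_{i=1}^{ℓ} λᵢT^{−i} + (ε₁/ε₂)·T^{−ℓ}·(T+1)^{−2}·(ε₂^((−1)^ℓ)·T + 1)
    + (ε₁/ε₂)·ε₂^((−1)^ℓ)·T^{ℓ−1}·ρ`. -/
theorem theta_decomposition {s : ℕ} (hs : 1 ≤ s) (ℓ : ℕ) (hℓ : 1 ≤ ℓ)
    (lam : ℕ → GaloisField 2 s) (ε₁ ε₂ : GaloisField 2 s)
    (hε₁ : ε₁ ≠ 0) (hε₂ : ε₂ ≠ 0)
    (hlam : ∀ n : ℕ, 1 ≤ n → n ≤ ℓ → lam n ≠ 0)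
    (hrec1 : ∀ m : ℕ,
      lam (ℓ + 2 * m + 1) = (ε₂ / ε₁) * ε₂ ^ ((-1 : ℤ) ^ (m + 1)) * (lam (m + 1)) ^ 2)
    (hrec2 : ∀ m : ℕ, lam (ℓ + 2 * m + 2) = ε₁ / ε₂)
    (T : LaurentSeries (GaloisField 2 s)) (hT : T = HahnSeries.single (-1 : ℤ) 1)
    (θ : LaurentSeries (GaloisField 2 s))
    (hθ : θ = HahnSeries.ofPowerSeries ℤ (GaloisField 2 s)
      (PowerSeries.mk fun i : ℕ => if 1 ≤ i then lam i else 0)) :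
    ∃ ρ : LaurentSeries (GaloisField 2 s),
      ρ ^ 2 + ρ + T ^ (-(2 * (ℓ : ℤ))) *
        (∑ i ∈ Finset.Icc 1 ℓ,
          algebraMap (GaloisField 2 s) (LaurentSeries (GaloisField 2 s))
            (1 + (lam i) ^ 2 * (ε₂ / ε₁) ^ 2 * ε₂ ^ ((-1 : ℤ) ^ i - (-1 : ℤ) ^ ℓ))
          * T ^ (-(2 * (i : ℤ)) + 2)) = 0 ∧
      θ = (∑ i ∈ Finset.Icc 1 ℓ,
            algebraMap (GaloisField 2 s) (LaurentSeries (GaloisField 2 s)) (lam i)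
              * T ^ (-(i : ℤ)))
        + algebraMap (GaloisField 2 s) (LaurentSeries (GaloisField 2 s)) (ε₁ / ε₂)
            * T ^ (-(ℓ : ℤ)) * (T + 1) ^ (-2 : ℤ)
            * (algebraMap (GaloisField 2 s) (LaurentSeries (GaloisField 2 s))
                (ε₂ ^ ((-1 : ℤ) ^ ℓ)) * T + 1)
        + algebraMap (GaloisField 2 s) (LaurentSeries (GaloisField 2 s))
            ((ε₁ / ε₂) * ε₂ ^ ((-1 : ℤ) ^ ℓ)) * T ^ ((ℓ : ℤ) - 1) * ρ := by
  have h2 : (2 : GaloisField 2 s) = 0 := CharTwo.two_eq_zero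
  set c := ε₁ / ε₂
  set σ := ε₂ ^ ((-1 : ℤ) ^ ℓ) with hσ
  have hc0 : c ≠ 0 := div_ne_zero hε₁ hε₂
  have hσ0 : σ ≠ 0 := zpow_ne_zero _ hε₂
  have he : ε₂ / ε₁ = c⁻¹ := (inv_div ε₁ ε₂).symm
  let g : ℕ → GaloisField 2 s := fun m => lam (ℓ + 2 * m + 1) / (c * σ) + 1
  have hg (m : ℕ) : g m =
      1 + lam (m + 1) ^ 2 * (ε₂ / ε₁) ^ 2 * ε₂ ^ ((-1 : ℤ) ^ (m + 1) - (-1 : ℤ) ^ ℓ) := by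
    simp only [g]
    rw [hrec1, zpow_sub₀ hε₂, ← hσ, he]
    field_simp
    ring
  have hg_even (j : ℕ) : g (ℓ + 2 * j) = g j ^ 2 := by
    have hpow : ε₂ ^ ((-1 : ℤ) ^ (ℓ + 2 * j + 1)) = σ⁻¹ := by
      rw [pow_succ, pow_add, pow_mul]
      simp [hσ]
    simp only [g]
    rw [hrec1, hpow, he, CharTwo.add_sq]
    field_simp
  have hg_odd (j : ℕ) : g (ℓ + (2 * j + 1)) = 0 := by
    have hpow : ε₂ ^ ((-1 : ℤ) ^ (ℓ + (2 * j + 1) + 1)) = σ := by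
      rw [show ℓ + (2 * j + 1) + 1 = ℓ + 2 * (j + 1) by ring, pow_add, pow_mul]
      simp [hσ]
    simp only [g]
    rw [hrec1, hpow, he, show ℓ + (2 * j + 1) + 1 = ℓ + 2 * j + 2 by ring, hrec2,
      ← CharTwo.add_self_eq_zero (1 : GaloisField 2 s)]
    field_simp
  have htail (m : ℕ) : lam (ℓ + 2 * m + 1) = c * σ * (1 + g m) := by
    simp only [g]
    rw [add_left_comm, CharTwo.add_self_eq_zero, add_zero]
    field_simp
  set A := algebraMap (GaloisField 2 s) (LaurentSeries (GaloisField 2 s))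
  let φ : PowerSeries (GaloisField 2 s) →+* LaurentSeries (GaloisField 2 s) :=
    HahnSeries.ofPowerSeries ℤ (GaloisField 2 s)
  let E : PowerSeries (GaloisField 2 s) := .expand 2 two_ne_zero (.mk 1)
  let H : PowerSeries (GaloisField 2 s) := .expand 2 two_ne_zero (.mk g)
  have hC (a : GaloisField 2 s) : φ (PowerSeries.C a) = A a :=
    (HahnSeries.ofPowerSeries_C a).trans (LaurentSeries.algebraMap_apply _ a).symm
  let x := φ PowerSeries.X
  have hx : x = HahnSeries.single 1 1 := HahnSeries.ofPowerSeries_X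
  have hx0 : x ≠ 0 := by simp [hx]
  have hTx : T = x⁻¹ := by simp [hT, hx]
  have hTpow (n : ℕ) : T ^ (-(n : ℤ)) = x ^ n := by simp [hTx]
  have hE : φ E * (1 + x) ^ 2 = 1 := by
    simpa using congrArg φ (PowerSeries.expand_two_mk_one_mul (R := GaloisField 2 s))
  have hx1 : 1 + x ≠ 0 := by
    intro h
    simp [h] at hE
  have hH : φ H = ∑ i ∈ Finset.range ℓ, A (g i) * x ^ (2 * i) +
      x ^ (2 * ℓ) * φ H ^ 2 := by
    have := congrArg (fun f => φ (.expand 2 two_ne_zero f))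
      (PowerSeries.mk_eq_sum_add_X_pow_mul_sq ℓ g hg_even hg_odd)
    simpa [PowerSeries.expand_C, hC, ← pow_mul] using this
  have hθ' : θ = ∑ i ∈ Finset.Icc 1 ℓ, A (lam i) * x ^ i +
      x ^ (ℓ + 1) * (A (c * σ) * (φ E + φ H)) +
      x ^ (ℓ + 2) * (A c * φ E) := by
    have hsplit : PowerSeries.mk (fun m => 1 + g m) = .mk 1 + .mk g := by
      ext; simp
    rw [hθ, PowerSeries.mk_eq_sum_add_of_tail ℓ lam _ _ _ htail hrec2, hsplit]
    change φ _ = _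
    simp only [map_add, map_mul, map_sum, map_pow, hC]
    rfl
  refine ⟨x ^ (2 * ℓ) * φ H, ?_, ?_⟩
  · have hsum : ∑ i ∈ Finset.Icc 1 ℓ,
          A (1 + lam i ^ 2 * (ε₂ / ε₁) ^ 2 * ε₂ ^ ((-1 : ℤ) ^ i - (-1 : ℤ) ^ ℓ))
          * T ^ (-(2 * (i : ℤ)) + 2) =
        ∑ i ∈ Finset.range ℓ, A (g i) * x ^ (2 * i) := by
      rw [Finset.range_eq_Ico, ← Finset.Ico_add_one_right_eq_Icc]
      refine (Finset.sum_Ico_add' _ 0 ℓ 1).symm.trans (Finset.sum_congr rfl fun i _ => ?_)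
      rw [hg, show -(2 * ((i + 1 : ℕ) : ℤ)) + 2 = -((2 * i : ℕ) : ℤ) by push_cast; ring, hTpow]
    have h2L : (2 : LaurentSeries (GaloisField 2 s)) = 0 :=
      (map_ofNat A 2).symm.trans ((congrArg A h2).trans (map_zero A))
    rw [hsum, show -(2 * (ℓ : ℤ)) = -((2 * ℓ : ℕ) : ℤ) by push_cast; rfl, hTpow]
    linear_combination x ^ (2 * ℓ) * hH + (x ^ (2 * ℓ) *
      ∑ i ∈ Finset.range ℓ, A (g i) * x ^ (2 * i) + x ^ (4 * ℓ) * φ H ^ 2) * h2L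
  · have hT1 : (T + 1) ^ (-2 : ℤ) = x ^ 2 * φ E := by
      have : T + 1 = (1 + x) / x := by rw [hTx]; field_simp
      rw [this, eq_div_of_mul_eq (pow_ne_zero 2 hx1) hE, zpow_neg]
      norm_cast
      field_simp
    have hTℓ : T ^ ((ℓ : ℤ) - 1) * x ^ (2 * ℓ) = x ^ (ℓ + 1) := by
      rw [hTx, inv_zpow', ← zpow_natCast x, ← zpow_natCast x, ← zpow_add₀ hx0]
      congr 1
      push_cast
      ring
    simp only [hTpow]
    rw [hθ', hT1, map_mul]
    have hxT : x * T = 1 := hTx ▸ mul_inv_cancel₀ hx0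
    linear_combination -(A c * A σ * φ H) * hTℓ - x ^ (ℓ + 1) * A c * A σ * φ E * hxT
end
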